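/- arXiv:1705.10408 — 10 statements merged into one kernel-verified Lean document; each statement's English description precedes it below -/
import Mathlib

section
/- Let n ≥ 1, let L be an n×n real weighted Laplacian matrix having the spanning-tree property, and let D be an n×n diagonal real matrix with strictly positive diagonal entries. Then the matrix B = D·L satisfies: B·𝟙 = 0; the eigenvalue 0 of B (viewed as a complex matrix) has algebraic multiplicity exactly one (i.e., 0 is a simple root of the characteristic polynomial of B); and every nonzero complex eigenvalue of B has strictly negative real part. -/
open Matrix Polynomial

/-- `L` is a weighted Laplacian: nonnegative off-diagonal entries and zero row sums. -/
def IsWeightedLaplacian {n : ℕ} (L : Matrix (Fin n) (Fin n) ℝ) : Prop :=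
  (∀ i j, i ≠ j → 0 ≤ L i j) ∧ ∀ i, ∑ j, L i j = 0

/-- The spanning-tree property: some node `r` reaches every node along arcs `j → i`
(present whenever `i ≠ j` and `L i j > 0`). -/
def HasSpanningTree {n : ℕ} (L : Matrix (Fin n) (Fin n) ℝ) : Prop :=
  ∃ r : Fin n, ∀ i : Fin n,
    Relation.ReflTransGen (fun a b : Fin n => b ≠ a ∧ 0 < L b a) r i

/-- Maximum principle on a single row. -/
lemma row_max {n : ℕ} {B : Matrix (Fin n) (Fin n) ℝ} (hB : IsWeightedLaplacian B)
    (v : Fin n → ℝ) (i : Fin n) : (B *ᵥ v) i = ∑ j, B i j * (v j - v i) := by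
  simp only [mul_sub, Finset.sum_sub_distrib, ← Finset.sum_mul, hB.2 i, Matrix.mulVec, dotProduct]
  ring

lemma row_nonpos {n : ℕ} {B : Matrix (Fin n) (Fin n) ℝ} (hB : IsWeightedLaplacian B)
    (v : Fin n → ℝ) (i : Fin n) (hi : ∀ j, v j ≤ v i) (j : Fin n) :
    B i j * (v j - v i) ≤ 0 := by
  by_cases h : i = j
  · subst h; simp
  · exact mul_nonpos_of_nonneg_of_nonpos (hB.1 i j h) (by linarith [hi j])

lemma const_nonpos {n : ℕ} (hn : 1 ≤ n) {B : Matrix (Fin n) (Fin n) ℝ}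
    (hB : IsWeightedLaplacian B) (v : Fin n → ℝ) (c : ℝ) (h : ∀ i, (B *ᵥ v) i = c) : c ≤ 0 := by
  have : Nonempty (Fin n) := ⟨⟨0, hn⟩⟩
  obtain ⟨i, hi⟩ := Finite.exists_max v
  rw [← h i, row_max hB]
  exact Finset.sum_nonpos fun j _ => row_nonpos hB v i hi j

lemma const_zero {n : ℕ} (hn : 1 ≤ n) {B : Matrix (Fin n) (Fin n) ℝ}
    (hB : IsWeightedLaplacian B) (v : Fin n → ℝ) (c : ℝ) (h : ∀ i, (B *ᵥ v) i = c) : c = 0 := by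
  have h1 := const_nonpos hn hB v c h
  have h2 := const_nonpos hn hB (-v) (-c) (fun i => by rw [Matrix.mulVec_neg, Pi.neg_apply, h])
  linarith

lemma le_root {n : ℕ} (hn : 1 ≤ n) {B : Matrix (Fin n) (Fin n) ℝ}
    (hB : IsWeightedLaplacian B) (r : Fin n)
    (hr : ∀ i : Fin n, Relation.ReflTransGen (fun a b : Fin n => b ≠ a ∧ 0 < B b a) r i)
    (v : Fin n → ℝ) (h : B *ᵥ v = 0) : ∀ j, v j ≤ v r := by
  have : Nonempty (Fin n) := ⟨⟨0, hn⟩⟩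
  obtain ⟨i, hi⟩ := Finite.exists_max v
  refine Relation.ReflTransGen.head_induction_on (motive := fun a _ => ∀ j, v j ≤ v a) (hr i) hi ?_
  intro a b hab _ hb
  have h0 : ∑ j, B b j * (v j - v b) = 0 := by rw [← row_max hB, h]; rfl
  rw [Finset.sum_eq_zero_iff_of_nonpos (fun j _ => row_nonpos hB v b hb j)] at h0
  have h1 := h0 a (Finset.mem_univ _)
  have h2 : v a = v b := by
    rcases mul_eq_zero.1 h1 with h | h
    · linarith [hab.2]
    · linarith
  rw [h2]; exact hb

lemma ker_const {n : ℕ} (hn : 1 ≤ n) {B : Matrix (Fin n) (Fin n) ℝ}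
    (hB : IsWeightedLaplacian B) (r : Fin n)
    (hr : ∀ i : Fin n, Relation.ReflTransGen (fun a b : Fin n => b ≠ a ∧ 0 < B b a) r i)
    (v : Fin n → ℝ) (h : B *ᵥ v = 0) : ∀ j, v j = v r := by
  intro j
  have h1 := le_root hn hB r hr v h j
  have h2 := le_root hn hB r hr (-v) (by rw [Matrix.mulVec_neg, h, neg_zero]) j
  simp only [Pi.neg_apply] at h2
  linarith

lemma mulVec_re {n : ℕ} (B : Matrix (Fin n) (Fin n) ℝ) (v : Fin n → ℂ) (i : Fin n) :
    ((B.map (algebraMap ℝ ℂ)) *ᵥ v) i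
      = ⟨(B *ᵥ fun j => (v j).re) i, (B *ᵥ fun j => (v j).im) i⟩ := by
  apply Complex.ext <;> simp [Matrix.mulVec, dotProduct]

lemma c_ker {n : ℕ} (hn : 1 ≤ n) {B : Matrix (Fin n) (Fin n) ℝ}
    (hB : IsWeightedLaplacian B) (r : Fin n)
    (hr : ∀ i : Fin n, Relation.ReflTransGen (fun a b : Fin n => b ≠ a ∧ 0 < B b a) r i)
    (v : Fin n → ℂ) (h : (B.map (algebraMap ℝ ℂ)) *ᵥ v = 0) : ∀ j, v j = v r := by
  have h' : ∀ i, _ := fun i => (mulVec_re B v i).symm.trans (congrFun h i)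
  intro j
  apply Complex.ext
  · exact ker_const hn hB r hr (fun j => (v j).re)
      (funext fun i => by simpa using congrArg Complex.re (h' i)) j
  · exact ker_const hn hB r hr (fun j => (v j).im)
      (funext fun i => by simpa using congrArg Complex.im (h' i)) j

lemma c_const {n : ℕ} (hn : 1 ≤ n) {B : Matrix (Fin n) (Fin n) ℝ}
    (hB : IsWeightedLaplacian B) (v : Fin n → ℂ) (c : ℂ)
    (h : ∀ i, ((B.map (algebraMap ℝ ℂ)) *ᵥ v) i = c) : c = 0 := by
  have h' : ∀ i, _ := fun i => (mulVec_re B v i).symm.trans (h i)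
  apply Complex.ext
  · exact const_zero hn hB (fun j => (v j).re) _ fun i => by simpa using congrArg Complex.re (h' i)
  · exact const_zero hn hB (fun j => (v j).im) _ fun i => by simpa using congrArg Complex.im (h' i)

lemma c_pow {n : ℕ} (hn : 1 ≤ n) {B : Matrix (Fin n) (Fin n) ℝ}
    (hB : IsWeightedLaplacian B) (r : Fin n)
    (hr : ∀ i : Fin n, Relation.ReflTransGen (fun a b : Fin n => b ≠ a ∧ 0 < B b a) r i)
    (k : ℕ) : ∀ (v : Fin n → ℂ),
    ((Matrix.toLin' (B.map (algebraMap ℝ ℂ))) ^ k) v = 0 → ∀ j, v j = v r := by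
  induction k with
  | zero => intro v h j; have : v = 0 := by simpa using h
            simp [this]
  | succ k ih =>
    intro v h
    rw [pow_succ, Module.End.mul_apply] at h
    have h1 := ih _ h
    rw [Matrix.toLin'_apply] at h1
    have h2 := c_const hn hB v _ h1
    exact c_ker hn hB r hr v (funext fun i => (h1 i).trans h2)

lemma c_one {n : ℕ} {B : Matrix (Fin n) (Fin n) ℝ}
    (hB : IsWeightedLaplacian B) : (B.map (algebraMap ℝ ℂ)) *ᵥ (fun _ => 1) = 0 := by
  funext i
  rw [mulVec_re]
  have := hB.2 i
  apply Complex.ext <;> simp [Matrix.mulVec, dotProduct, this]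

lemma c_mult {n : ℕ} (hn : 1 ≤ n) {B : Matrix (Fin n) (Fin n) ℝ}
    (hB : IsWeightedLaplacian B) (r : Fin n)
    (hr : ∀ i : Fin n, Relation.ReflTransGen (fun a b : Fin n => b ≠ a ∧ 0 < B b a) r i) :
    Polynomial.rootMultiplicity (0 : ℂ) (B.map (algebraMap ℝ ℂ)).charpoly = 1 := by
  rw [← Matrix.charpoly_toLin', ← LinearMap.finrank_maxGenEigenspace_eq]
  have hm : Module.End.maxGenEigenspace (Matrix.toLin' (B.map (algebraMap ℝ ℂ))) 0
      = Submodule.span ℂ {(fun _ => 1 : Fin n → ℂ)} := by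
    ext v
    rw [Module.End.mem_maxGenEigenspace, Submodule.mem_span_singleton]
    simp only [zero_smul, sub_zero]
    constructor
    · rintro ⟨k, hk⟩
      refine ⟨v r, funext fun j => ?_⟩
      simp [c_pow hn hB r hr k v hk j]
    · rintro ⟨a, rfl⟩
      refine ⟨1, ?_⟩
      rw [pow_one, map_smul, Matrix.toLin'_apply, c_one hB, smul_zero]
  rw [hm]
  exact finrank_span_singleton (fun h => one_ne_zero (congrFun h r))

lemma c_neg {n : ℕ} {B : Matrix (Fin n) (Fin n) ℝ} (hB : IsWeightedLaplacian B)
    (μ : ℂ) (h0 : μ ≠ 0) (h : (B.map (algebraMap ℝ ℂ)).charpoly.IsRoot μ) : μ.re < 0 := by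
  rw [← Matrix.charpoly_toLin', ← Module.End.hasEigenvalue_iff_isRoot_charpoly] at h
  obtain ⟨k, hk⟩ := eigenvalue_mem_ball h
  have hs : ∑ j ∈ Finset.univ.erase k, ‖(B.map (algebraMap ℝ ℂ)) k j‖ = - B k k := by
    have h1 : ∑ j ∈ Finset.univ.erase k, ‖(B.map (algebraMap ℝ ℂ)) k j‖
        = ∑ j ∈ Finset.univ.erase k, B k j := by
      refine Finset.sum_congr rfl fun j hj => ?_
      simp [abs_of_nonneg (hB.1 k j (Finset.ne_of_mem_erase hj).symm)]
    have h2 := Finset.add_sum_erase Finset.univ (fun j => B k j) (Finset.mem_univ k)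
    have h3 := hB.2 k
    rw [h1]; linarith
  rw [hs, mem_closedBall_iff_norm] at hk
  have hd : 0 ≤ - B k k := (norm_nonneg _).trans hk
  by_contra! hre
  have hsq : ‖μ - (B.map (algebraMap ℝ ℂ)) k k‖ ^ 2 ≤ (- B k k) ^ 2 := by gcongr
  rw [Complex.sq_norm, Complex.normSq_apply] at hsq
  simp at hsq
  have hm := mul_nonneg hd hre
  have hr0 : μ.re = 0 := by nlinarith [sq_nonneg μ.im, sq_nonneg μ.re]
  have hi0 : μ.im = 0 := by nlinarith [sq_nonneg μ.im, sq_nonneg μ.re]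
  exact h0 (Complex.ext hr0 hi0)

theorem laplacian_diag_scaled_spectrum {n : ℕ} (hn : 1 ≤ n)
    (L D : Matrix (Fin n) (Fin n) ℝ)
    (hL : IsWeightedLaplacian L) (hTree : HasSpanningTree L)
    (hDdiag : ∀ i j, i ≠ j → D i j = 0) (hDpos : ∀ i, 0 < D i i) :
    (D * L).mulVec (fun _ => 1) = 0 ∧
    Polynomial.rootMultiplicity (0 : ℂ) ((D * L).map (algebraMap ℝ ℂ)).charpoly = 1 ∧
    ∀ μ : ℂ, μ ≠ 0 → ((D * L).map (algebraMap ℝ ℂ)).charpoly.IsRoot μ → μ.re < 0 := by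
  have hDL : ∀ i j, (D * L) i j = D i i * L i j := by
    intro i j
    rw [Matrix.mul_apply, Finset.sum_eq_single i]
    · intro b _ hb; rw [hDdiag i b hb.symm, zero_mul]
    · simp
  have hB : IsWeightedLaplacian (D * L) := by
    refine ⟨fun i j hij => ?_, fun i => ?_⟩
    · rw [hDL]; exact mul_nonneg (hDpos i).le (hL.1 i j hij)
    · simp only [hDL, ← Finset.mul_sum, hL.2 i, mul_zero]
  obtain ⟨r, hr⟩ := hTree
  have hr' : ∀ i : Fin n,
      Relation.ReflTransGen (fun a b : Fin n => b ≠ a ∧ 0 < (D * L) b a) r i := fun i =>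
    Relation.ReflTransGen.mono (fun a b hab => ⟨hab.1, by rw [hDL]; exact mul_pos (hDpos b) hab.2⟩) _ _ (hr i)
  refine ⟨?_, c_mult hn hB r hr', fun μ h0 h => c_neg hB μ h0 h⟩
  funext i
  simpa [Matrix.mulVec, dotProduct] using hB.2 i
end

section
/- Let n ≥ 2, let L be an n×n real weighted Laplacian matrix having the spanning-tree property, let D be an n×n diagonal real matrix with strictly positive diagonal entries, and set B = D·L. Then there exists an invertible real n×n matrix T whose first column is the all-ones vector 𝟙 such that the matrix T⁻¹·B·T has all entries of its first row and of its first column equal to zero, and its lower-right (n−1)×(n−1) block B* is Hurwitz. -/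
open Matrix Polynomial

/-- A real square matrix is Hurwitz if all its complex eigenvalues (roots of the
characteristic polynomial over `ℂ`) have strictly negative real part. -/
def IsHurwitz {m : ℕ} (A : Matrix (Fin m) (Fin m) ℝ) : Prop :=
  ∀ μ : ℂ, (A.map (algebraMap ℝ ℂ)).charpoly.IsRoot μ → μ.re < 0

/-- Maximum principle: off-diagonal nonnegativity and zero row sums. -/
lemma lap_sum_eq {n : ℕ} {B : Matrix (Fin n) (Fin n) ℝ} (hB : IsWeightedLaplacian B)
    (x : Fin n → ℝ) (i : Fin n) : (B *ᵥ x) i = ∑ j, B i j * (x j - x i) := by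
  simp only [mul_sub, Finset.sum_sub_distrib, ← Finset.sum_mul, hB.2 i, zero_mul, sub_zero]
  rfl

lemma lap_max_terms {n : ℕ} {B : Matrix (Fin n) (Fin n) ℝ} (hB : IsWeightedLaplacian B)
    (x : Fin n → ℝ) (i : Fin n) (hi : ∀ j, x j ≤ x i) (j : Fin n) :
    B i j * (x j - x i) ≤ 0 := by
  by_cases h : i = j
  · subst h; simp
  · exact mul_nonpos_of_nonneg_of_nonpos (hB.1 i j h) (sub_nonpos.2 (hi j))

lemma lap_ne_one {n : ℕ} [NeZero n] {B : Matrix (Fin n) (Fin n) ℝ} (hB : IsWeightedLaplacian B)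
    (x : Fin n → ℝ) : B *ᵥ x ≠ fun _ => 1 := by
  intro h
  obtain ⟨i, hi⟩ := Finite.exists_max x
  have h1 := congrFun h i
  rw [lap_sum_eq hB] at h1
  have := Finset.sum_nonpos (fun j (_ : j ∈ Finset.univ) => lap_max_terms hB x i hi j)
  linarith

lemma lap_le_root {n : ℕ} [NeZero n] {B : Matrix (Fin n) (Fin n) ℝ} (hB : IsWeightedLaplacian B)
    (r : Fin n) (hr : ∀ i : Fin n,
      Relation.ReflTransGen (fun a b : Fin n => b ≠ a ∧ 0 < B b a) r i)
    (x : Fin n → ℝ) (h : B *ᵥ x = 0) (k : Fin n) : x k ≤ x r := by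
  obtain ⟨i, hi⟩ := Finite.exists_max x
  have key : ∀ a, Relation.ReflTransGen (fun a b : Fin n => b ≠ a ∧ 0 < B b a) a i →
      x a = x i := by
    intro a ha
    induction ha using Relation.ReflTransGen.head_induction_on with
    | refl => rfl
    | @head a c hac _ ih =>
      have hc : ∀ j, x j ≤ x c := fun j => by rw [ih]; exact hi j
      have h1 := congrFun h c
      rw [lap_sum_eq hB, Pi.zero_apply,
        Finset.sum_eq_zero_iff_of_nonpos (fun j _ => lap_max_terms hB x c hc j)] at h1
      have h2 := h1 a (Finset.mem_univ _)
      rcases mul_eq_zero.1 h2 with h3 | h3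
      · exact absurd h3 hac.2.ne'
      · linarith
  rw [key r (hr i)]
  exact hi k

lemma lap_ker {n : ℕ} [NeZero n] {B : Matrix (Fin n) (Fin n) ℝ} (hB : IsWeightedLaplacian B)
    (r : Fin n) (hr : ∀ i : Fin n,
      Relation.ReflTransGen (fun a b : Fin n => b ≠ a ∧ 0 < B b a) r i)
    (x : Fin n → ℝ) (h : B *ᵥ x = 0) (k : Fin n) : x k = x r := by
  apply le_antisymm (lap_le_root hB r hr x h k)
  have := lap_le_root hB r hr (-x) (by rw [Matrix.mulVec_neg, h, neg_zero]) k
  simpa using this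

lemma lap_left {n : ℕ} [NeZero n] {B : Matrix (Fin n) (Fin n) ℝ} (hB : IsWeightedLaplacian B) :
    ∃ w : Fin n → ℝ, w ᵥ* B = 0 ∧ ∑ i, w i = 1 := by
  have hnot : (fun _ => 1 : Fin n → ℝ) ∉ LinearMap.range (Matrix.toLin' B) := by
    rintro ⟨x, hx⟩
    exact lap_ne_one hB x (by simpa using hx)
  obtain ⟨f, hf1, hf2⟩ := Submodule.exists_le_ker_of_notMem hnot
  have hf : ∀ x, f x = ∑ i, f (Pi.single i 1) * x i := by
    intro x
    conv_lhs => rw [← Finset.univ_sum_single x]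
    rw [map_sum]
    refine Finset.sum_congr rfl fun i _ => ?_
    have : Pi.single i (x i) = x i • (Pi.single i 1 : Fin n → ℝ) := by
      rw [← Pi.single_smul]; simp
    rw [this, map_smul, smul_eq_mul, mul_comm]
  refine ⟨fun i => f (Pi.single i 1) / f (fun _ => 1), ?_, ?_⟩
  · ext j
    have h0 : f (Matrix.toLin' B (Pi.single j 1)) = 0 := hf2 ⟨_, rfl⟩
    rw [hf] at h0
    simp only [Matrix.toLin'_apply, Matrix.mulVec_single_one, Matrix.col_apply] at h0
    simp only [Matrix.vecMul, dotProduct, div_mul_eq_mul_div, ← Finset.sum_div, Pi.zero_apply]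
    rw [h0, zero_div]
  · rw [← Finset.sum_div, div_eq_one_iff_eq hf1, hf (fun _ => 1)]
    simp

lemma lap_gersh {n : ℕ} {B : Matrix (Fin n) (Fin n) ℝ} (hB : IsWeightedLaplacian B)
    (μ : ℂ) (hμ : μ ≠ 0) (x : Fin n → ℂ) (hx : x ≠ 0)
    (h : (B.map (algebraMap ℝ ℂ)) *ᵥ x = μ • x) : μ.re < 0 := by
  have he : Module.End.HasEigenvalue (Matrix.toLin' (B.map (algebraMap ℝ ℂ))) μ := by
    refine Module.End.hasEigenvalue_of_hasEigenvector (x := x) ⟨?_, hx⟩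
    rw [Module.End.mem_eigenspace_iff, Matrix.toLin'_apply, h]
  obtain ⟨k, hk⟩ := eigenvalue_mem_ball he
  have hs : ∑ j ∈ Finset.univ.erase k, ‖(B.map (algebraMap ℝ ℂ)) k j‖ = - B k k := by
    have h1 : ∑ j ∈ Finset.univ.erase k, ‖(B.map (algebraMap ℝ ℂ)) k j‖
        = ∑ j ∈ Finset.univ.erase k, B k j := by
      refine Finset.sum_congr rfl fun j hj => ?_
      have := hB.1 k j (Finset.ne_of_mem_erase hj).symm
      simp [abs_of_nonneg this]
    have h2 := Finset.add_sum_erase Finset.univ (fun j => B k j) (Finset.mem_univ k)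
    rw [h1]
    have h3 := hB.2 k
    linarith
  rw [hs, Metric.mem_closedBall, dist_eq_norm] at hk
  have hb : 0 ≤ - B k k := (norm_nonneg _).trans hk
  have hsq := pow_le_pow_left₀ (norm_nonneg _) hk 2
  rw [← Complex.normSq_eq_norm_sq, Complex.normSq_apply] at hsq
  simp only [Matrix.map_apply, Complex.coe_algebraMap, Complex.sub_re, Complex.sub_im,
    Complex.ofReal_re, Complex.ofReal_im, sub_zero] at hsq
  by_contra hre
  push Not at hre
  have hpos : 0 < μ.re * μ.re + μ.im * μ.im := by
    rw [← Complex.normSq_apply]; exact Complex.normSq_pos.2 hμ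
  nlinarith [mul_nonneg hre hb]

lemma lap_ker_complex {n : ℕ} [NeZero n] {B : Matrix (Fin n) (Fin n) ℝ}
    (hB : IsWeightedLaplacian B) (r : Fin n) (hr : ∀ i : Fin n,
      Relation.ReflTransGen (fun a b : Fin n => b ≠ a ∧ 0 < B b a) r i)
    (x : Fin n → ℂ) (h : (B.map (algebraMap ℝ ℂ)) *ᵥ x = 0) (k : Fin n) : x k = x r := by
  apply Complex.ext
  · refine lap_ker hB r hr (fun i => (x i).re) ?_ k
    ext i
    have := congrArg Complex.re (congrFun h i)
    simpa [Matrix.mulVec, dotProduct] using this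
  · refine lap_ker hB r hr (fun i => (x i).im) ?_ k
    ext i
    have := congrArg Complex.im (congrFun h i)
    simpa [Matrix.mulVec, dotProduct] using this

lemma lap_decomp {m : ℕ} {B : Matrix (Fin (m + 1)) (Fin (m + 1)) ℝ}
    (hB : IsWeightedLaplacian B) (hTree : HasSpanningTree B) :
    ∃ T : Matrix (Fin (m + 1)) (Fin (m + 1)) ℝ, IsUnit T ∧
      (∀ i, T i 0 = 1) ∧ (∀ j, (T⁻¹ * B * T) 0 j = 0) ∧ (∀ i, (T⁻¹ * B * T) i 0 = 0) ∧
      IsHurwitz (fun i j : Fin m => (T⁻¹ * B * T) i.succ j.succ) := by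
  obtain ⟨r, hr⟩ := hTree
  obtain ⟨w, hw, hw1⟩ := lap_left hB
  let T : Matrix (Fin (m + 1)) (Fin (m + 1)) ℝ := fun i j =>
    Fin.cases 1 (fun j' => (if i = j'.succ then 1 else 0) - w j'.succ) j
  have hT0 : ∀ i, T i 0 = 1 := fun i => rfl
  have hTs : ∀ i (j : Fin m), T i j.succ = (if i = j.succ then 1 else 0) - w j.succ :=
    fun i j => rfl
  have hwT : w ᵥ* T = Pi.single 0 1 := by
    ext j
    refine Fin.cases ?_ (fun j => ?_) j
    · simp [Matrix.vecMul, dotProduct, hT0, hw1]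
    · simp [Matrix.vecMul, dotProduct, hTs, mul_sub, Finset.sum_sub_distrib, ← Finset.sum_mul, hw1]
  have hdet : T.det ≠ 0 := by
    intro h0
    obtain ⟨v, hv, hTv⟩ := Matrix.exists_mulVec_eq_zero_iff.2 h0
    apply hv
    have hv0 : v 0 = 0 := by
      have : w ⬝ᵥ (T *ᵥ v) = 0 := by rw [hTv]; simp
      rw [Matrix.dotProduct_mulVec, hwT] at this
      simpa using this
    have hc : ∀ i, ∑ j : Fin m, ((if i = j.succ then 1 else 0) - w j.succ) * v j.succ = 0 := by
      intro i
      have := congrFun hTv i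
      simpa [Matrix.mulVec, dotProduct, Fin.sum_univ_succ, hT0, hTs, hv0] using this
    have hc0 := hc 0
    simp only [(Fin.succ_ne_zero _).symm, if_false, zero_sub, neg_mul, Finset.sum_neg_distrib,
      neg_eq_zero] at hc0
    ext i
    refine Fin.cases hv0 (fun i => ?_) i
    have := hc i.succ
    simpa [sub_mul, Finset.sum_sub_distrib, hc0] using this
  have hTu : IsUnit T.det := isUnit_iff_ne_zero.2 hdet
  have hinv : ∀ j, T⁻¹ 0 j = w j := by
    intro j
    have h1 : (w ᵥ* T) ᵥ* T⁻¹ = w := by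
      rw [Matrix.vecMul_vecMul, Matrix.mul_nonsing_inv _ hTu, Matrix.vecMul_one]
    rw [hwT, Matrix.single_one_vecMul] at h1
    exact congrFun h1 j
  have hrow : ∀ j, (T⁻¹ * B * T) 0 j = 0 := by
    intro j
    rw [Matrix.mul_apply]
    refine Finset.sum_eq_zero fun k _ => ?_
    have : (T⁻¹ * B) 0 k = (w ᵥ* B) k := by
      simp [Matrix.mul_apply, Matrix.vecMul, dotProduct, hinv]
    rw [this, hw]; simp
  have hcol : ∀ i, (T⁻¹ * B * T) i 0 = 0 := by
    intro i
    rw [Matrix.mul_assoc, Matrix.mul_apply]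
    refine Finset.sum_eq_zero fun k _ => ?_
    have : (B * T) k 0 = 0 := by simp [Matrix.mul_apply, hT0, hB.2]
    rw [this, mul_zero]
  refine ⟨T, (Matrix.isUnit_iff_isUnit_det _).2 hTu, hT0, hrow, hcol, ?_⟩
  intro μ hμ
  rw [Polynomial.IsRoot.def, Matrix.eval_charpoly] at hμ
  obtain ⟨v, hv, hvμ⟩ := Matrix.exists_mulVec_eq_zero_iff.2 hμ
  rw [Matrix.sub_mulVec, sub_eq_zero] at hvμ
  let φ : ℝ →+* ℂ := algebraMap ℝ ℂ
  set M := T⁻¹ * B * T with hM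
  let u : Fin (m + 1) → ℂ := Fin.cons 0 v
  have hMu : (M.map φ) *ᵥ u = μ • u := by
    ext i
    refine Fin.cases ?_ (fun i => ?_) i
    · simp [Matrix.mulVec, dotProduct, hrow, u]
    · have := congrFun hvμ i
      simp only [Matrix.scalar_apply, Matrix.mulVec_diagonal] at this
      simp only [Matrix.mulVec, dotProduct, Fin.sum_univ_succ, u, Fin.cons_zero, Fin.cons_succ,
        mul_zero, zero_add, Pi.smul_apply, smul_eq_mul]
      rw [this]
      rfl
  have hTM : T * M = B * T := by
    rw [hM, ← Matrix.mul_assoc, ← Matrix.mul_assoc, Matrix.mul_nonsing_inv _ hTu, Matrix.one_mul]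
  let x := (T.map φ) *ᵥ u
  have hBx : (B.map φ) *ᵥ x = μ • x := by
    change (B.map φ) *ᵥ ((T.map φ) *ᵥ u) = μ • ((T.map φ) *ᵥ u)
    rw [Matrix.mulVec_mulVec, ← Matrix.map_mul, ← hTM, Matrix.map_mul, ← Matrix.mulVec_mulVec,
      hMu, Matrix.mulVec_smul]
  have hu : u ≠ 0 := by
    intro h
    apply hv
    ext i
    exact congrFun h i.succ
  have hx : x ≠ 0 := by
    intro h
    apply hu
    have : (T⁻¹.map φ) *ᵥ x = u := by
      change (T⁻¹.map φ) *ᵥ ((T.map φ) *ᵥ u) = u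
      rw [Matrix.mulVec_mulVec, ← Matrix.map_mul, Matrix.nonsing_inv_mul _ hTu]
      simp
    rw [← this, h, Matrix.mulVec_zero]
  by_cases h0 : μ = 0
  · exfalso
    rw [h0, zero_smul] at hBx
    have hk := lap_ker_complex hB r hr x hBx
    have hwx : ∑ i, (w i : ℂ) * x i = 0 := by
      have h1 : (fun i => (w i : ℂ)) ⬝ᵥ ((T.map φ) *ᵥ u) = 0 := by
        have h2 : (fun i => (w i : ℂ)) ᵥ* (T.map φ) = Pi.single 0 1 := by
          ext j
          have := congrArg (fun t : ℝ => (t : ℂ)) (congrFun hwT j)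
          simp only [Matrix.vecMul, dotProduct, Complex.ofReal_sum, Complex.ofReal_mul] at this
          simp only [Matrix.vecMul, dotProduct, Matrix.map_apply]
          refine this.trans ?_
          by_cases hj : j = 0
          · subst hj; simp
          · simp [hj]
        rw [Matrix.dotProduct_mulVec, h2]
        simp [u]
      exact h1
    have hs : ∑ i, (w i : ℂ) * x i = x r := by
      rw [Finset.sum_congr rfl (fun i _ => by rw [hk i]), ← Finset.sum_mul, ← Complex.ofReal_sum,
        hw1]
      simp
    apply hx
    ext i
    rw [hk i, ← hs, hwx]; rfl
  · exact lap_gersh hB μ h0 x hx hBx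

theorem laplacian_similarity_decomposition {n : ℕ} (hn : 2 ≤ n)
    (L D : Matrix (Fin n) (Fin n) ℝ)
    (hL : IsWeightedLaplacian L) (hTree : HasSpanningTree L)
    (hDdiag : ∀ i j, i ≠ j → D i j = 0) (hDpos : ∀ i, 0 < D i i) :
    ∃ T : Matrix (Fin n) (Fin n) ℝ, IsUnit T ∧
      (∀ i : Fin n, T i ⟨0, by omega⟩ = 1) ∧
      (∀ j : Fin n, (T⁻¹ * (D * L) * T) ⟨0, by omega⟩ j = 0) ∧
      (∀ i : Fin n, (T⁻¹ * (D * L) * T) i ⟨0, by omega⟩ = 0) ∧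
      IsHurwitz (fun i j : Fin (n - 1) =>
        (T⁻¹ * (D * L) * T) ⟨i.val + 1, by have := i.isLt; omega⟩
          ⟨j.val + 1, by have := j.isLt; omega⟩) := by
  have hDL : ∀ i j, (D * L) i j = D i i * L i j := by
    intro i j
    rw [Matrix.mul_apply]
    refine Finset.sum_eq_single i (fun k _ hk => ?_) (by simp)
    rw [hDdiag i k hk.symm, zero_mul]
  have hB : IsWeightedLaplacian (D * L) := by
    refine ⟨fun i j hij => ?_, fun i => ?_⟩
    · rw [hDL]; exact mul_nonneg (hDpos i).le (hL.1 i j hij)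
    · simp only [hDL, ← Finset.mul_sum, hL.2 i, mul_zero]
  have hBT : HasSpanningTree (D * L) := by
    obtain ⟨r, hr⟩ := hTree
    refine ⟨r, fun i => Relation.ReflTransGen.mono (fun a b hab => ⟨hab.1, ?_⟩) _ _ (hr i)⟩
    rw [hDL]; exact mul_pos (hDpos b) hab.2
  obtain ⟨m, rfl⟩ : ∃ m, n = m + 1 := ⟨n - 1, by omega⟩
  exact lap_decomp hB hBT
end

section
/- Let A be an n×n real Hurwitz matrix and let Q be an n×n real symmetric positive definite matrix. Then there exists an n×n real symmetric positive definite matrix R such that R·A + Aᵀ·R = −Q. -/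
open Matrix Polynomial

section Aux

open scoped Matrix.Norms.Frobenius
open Filter Topology

theorem aux_decay {n : ℕ} [NeZero n] (M : Matrix (Fin n) (Fin n) ℂ)
    (h : ∀ z ∈ spectrum ℂ M, ‖z‖ < 1) :
    ∃ r : ℝ, 0 ≤ r ∧ r < 1 ∧ ∀ᶠ k : ℕ in atTop, ‖M ^ k‖ ≤ r ^ k := by
  have : CompleteSpace (Matrix (Fin n) (Fin n) ℂ) := FiniteDimensional.complete ℂ _
  have h1 : spectralRadius ℂ M < ((1 : NNReal) : ENNReal) :=
    spectrum.spectralRadius_lt_of_forall_lt M (fun z hz => by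
      have := h z hz
      exact_mod_cast this)
  obtain ⟨r, hr1, hr2⟩ := ENNReal.lt_iff_exists_nnreal_btwn.1 h1
  refine ⟨r, r.2, by exact_mod_cast hr2, ?_⟩
  have h2 := spectrum.pow_nnnorm_pow_one_div_tendsto_nhds_spectralRadius M
  filter_upwards [h2.eventually (gt_mem_nhds hr1), eventually_gt_atTop 0] with k hk hk0
  have hk' : (0 : ℝ) < k := by exact_mod_cast hk0
  have h3 := ENNReal.rpow_le_rpow hk.le hk'.le
  rw [← ENNReal.rpow_mul, one_div, inv_mul_cancel₀ hk'.ne', ENNReal.rpow_one,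
    ENNReal.rpow_natCast] at h3
  have h4 : ‖M ^ k‖₊ ≤ r ^ k := by exact_mod_cast h3
  exact_mod_cast h4

theorem aux_summable {n : ℕ} [NeZero n] (B Q : Matrix (Fin n) (Fin n) ℝ)
    (h : ∀ z ∈ spectrum ℂ (B.map (algebraMap ℝ ℂ)), ‖z‖ < 1) :
    Summable (fun k : ℕ => (B ^ k)ᵀ * Q * B ^ k) := by
  have : CompleteSpace (Matrix (Fin n) (Fin n) ℝ) := FiniteDimensional.complete ℝ _
  obtain ⟨r, hr0, hr1, hr⟩ := aux_decay _ h
  have hs : Summable (fun k : ℕ => ‖Q‖ * r ^ k) :=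
    (summable_geometric_of_lt_one hr0 hr1).mul_left _
  refine Summable.of_norm_bounded_eventually_nat hs ?_
  filter_upwards [hr] with k hk
  have e : ‖B ^ k‖ ≤ r ^ k := by
    have e1 : (B.map (algebraMap ℝ ℂ)) ^ k = (B ^ k).map (algebraMap ℝ ℂ) :=
      (map_pow (algebraMap ℝ ℂ).mapMatrix B k).symm
    rw [e1, frobenius_norm_map_eq _ _ (fun a => by simp)] at hk
    exact hk
  have hrk : r ^ k ≤ 1 := pow_le_one₀ hr0 hr1.le
  have hrk0 : 0 ≤ r ^ k := pow_nonneg hr0 k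
  calc ‖(B ^ k)ᵀ * Q * B ^ k‖ ≤ ‖(B ^ k)ᵀ * Q‖ * ‖B ^ k‖ := norm_mul_le _ _
    _ ≤ (‖(B ^ k)ᵀ‖ * ‖Q‖) * ‖B ^ k‖ := by gcongr; exact norm_mul_le _ _
    _ = (‖B ^ k‖ * ‖Q‖) * ‖B ^ k‖ := by rw [frobenius_norm_transpose]
    _ ≤ (1 * ‖Q‖) * r ^ k := by gcongr; exact e.trans hrk
    _ = ‖Q‖ * r ^ k := by ring

end Aux

theorem aux_stein {n : ℕ} [NeZero n] (B Q : Matrix (Fin n) (Fin n) ℝ)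
    (h : ∀ z ∈ spectrum ℂ (B.map (algebraMap ℝ ℂ)), ‖z‖ < 1) (hQ : Q.PosDef) :
    ∃ R : Matrix (Fin n) (Fin n) ℝ, R.PosDef ∧ R = Q + Bᵀ * R * B := by
  have hT := aux_summable B Q h
  have hpsd : ∀ k : ℕ, ((B ^ k)ᵀ * Q * B ^ k).PosSemidef := fun k => by
    have := hQ.posSemidef.conjTranspose_mul_mul_same (B ^ k)
    rwa [conjTranspose_eq_transpose_of_trivial] at this
  obtain ⟨R, hR⟩ := hT
  have hRpsd : R.PosSemidef := by
    refine PosSemidef.of_dotProduct_mulVec_nonneg ?_ ?_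
    · have h1 : HasSum (fun k : ℕ => (B ^ k)ᵀ * Q * B ^ k) Rᴴ := by
        have := hR.matrix_conjTranspose
        have e : (fun k : ℕ => ((B ^ k)ᵀ * Q * B ^ k)ᴴ) = fun k : ℕ => (B ^ k)ᵀ * Q * B ^ k :=
          funext fun k => (hpsd k).isHermitian
        rwa [e] at this
      exact h1.unique hR
    · intro x
      have hc : Continuous (fun M : Matrix (Fin n) (Fin n) ℝ => star x ⬝ᵥ M *ᵥ x) := by
        fun_prop
      let f : Matrix (Fin n) (Fin n) ℝ →+ ℝ :=
        { toFun := fun M => star x ⬝ᵥ M *ᵥ x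
          map_zero' := by simp
          map_add' := fun a b => by simp [add_mulVec, dotProduct_add] }
      have h1 := hR.map f hc
      exact h1.nonneg (fun k => (hpsd k).dotProduct_mulVec_nonneg x)
  have heq : R = Q + Bᵀ * R * B := by
    have h1 : HasSum (fun k : ℕ => (B ^ (k + 1))ᵀ * Q * B ^ (k + 1)) (Bᵀ * R * B) := by
      have := (hR.mul_left Bᵀ).mul_right B
      have e : (fun k : ℕ => Bᵀ * ((B ^ k)ᵀ * Q * B ^ k) * B)
          = fun k : ℕ => (B ^ (k + 1))ᵀ * Q * B ^ (k + 1) := by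
        funext k
        rw [pow_succ, transpose_mul]
        simp only [mul_assoc]
      rwa [e] at this
    have h2 := (hasSum_nat_add_iff' (f := fun k : ℕ => (B ^ k)ᵀ * Q * B ^ k) 1).2 hR
    have h3 := h1.unique h2
    rw [h3]
    simp
  refine ⟨R, ?_, heq⟩
  rw [heq]
  refine hQ.add_posSemidef ?_
  have := hRpsd.conjTranspose_mul_mul_same B
  rwa [conjTranspose_eq_transpose_of_trivial] at this

theorem aux_cayley {n : ℕ} (M N : Matrix (Fin n) (Fin n) ℂ)
    (hM : ∀ z ∈ spectrum ℂ M, z.re < 0) (hN : N * (1 - M) = 1) :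
    ∀ z ∈ spectrum ℂ ((1 + M) * N), ‖z‖ < 1 := by
  intro z hz
  by_contra hlt
  push Not at hlt
  apply hz
  have hN' : (1 - M) * N = 1 := mul_eq_one_comm.1 hN
  have hNu : IsUnit N := IsUnit.of_mul_eq_one _ hN
  have key : algebraMap ℂ (Matrix (Fin n) (Fin n) ℂ) z - (1 + M) * N
      = ((z - 1) • (1 : Matrix (Fin n) (Fin n) ℂ) - (z + 1) • M) * N := by
    have : algebraMap ℂ (Matrix (Fin n) (Fin n) ℂ) z = z • ((1 - M) * N) := by
      rw [hN', Algebra.algebraMap_eq_smul_one]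
    rw [this, ← smul_mul_assoc, ← sub_mul]
    congr 1
    module
  rw [spectrum.mem_resolventSet_iff, key]
  refine IsUnit.mul ?_ hNu
  by_cases h1 : z + 1 = 0
  · have hz1 : z - 1 = -2 := by linear_combination h1
    rw [h1, zero_smul, sub_zero, hz1]
    rw [← Algebra.algebraMap_eq_smul_one]
    exact (IsUnit.mk0 (-2 : ℂ) (by norm_num)).map (algebraMap ℂ (Matrix (Fin n) (Fin n) ℂ))
  · have hres : (z - 1) / (z + 1) ∉ spectrum ℂ M := by
      intro hmem
      have := hM _ hmem
      have hre : ((z - 1) / (z + 1)).re = (Complex.normSq z - 1) / Complex.normSq (z + 1) := by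
        rw [Complex.div_re, ← add_div]
        congr 1
        simp [Complex.normSq_apply]
        ring
      rw [hre] at this
      have h2 : 0 ≤ Complex.normSq z - 1 := by
        rw [Complex.normSq_eq_norm_sq]
        nlinarith
      exact absurd this (not_lt.2 (div_nonneg h2 (Complex.normSq_nonneg _)))
    have hu := spectrum.notMem_iff.1 hres
    have e : (z - 1) • (1 : Matrix (Fin n) (Fin n) ℂ) - (z + 1) • M
        = algebraMap ℂ (Matrix (Fin n) (Fin n) ℂ) (z + 1) *
          (algebraMap ℂ (Matrix (Fin n) (Fin n) ℂ) ((z - 1) / (z + 1)) - M) := by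
      rw [Algebra.algebraMap_eq_smul_one, Algebra.algebraMap_eq_smul_one, smul_mul_assoc,
        one_mul, smul_sub, smul_smul, mul_div_cancel₀ _ h1]
    rw [e]
    exact ((IsUnit.mk0 _ h1).map (algebraMap ℂ (Matrix (Fin n) (Fin n) ℂ))).mul hu

theorem lyapunov_equation_solution {n : ℕ} (A Q : Matrix (Fin n) (Fin n) ℝ)
    (hA : IsHurwitz A) (hQ : Q.PosDef) :
    ∃ R : Matrix (Fin n) (Fin n) ℝ, R.PosDef ∧ R * A + Aᵀ * R = -Q := by
  rcases Nat.eq_zero_or_pos n with h0 | hpos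
  · subst h0
    exact ⟨Q, hQ, Subsingleton.elim _ _⟩
  have : NeZero n := ⟨hpos.ne'⟩
  have hspec : ∀ z ∈ spectrum ℂ (A.map (algebraMap ℝ ℂ)), z.re < 0 := fun z hz =>
    hA z (Matrix.mem_spectrum_iff_isRoot_charpoly.1 hz)
  have hdet : IsUnit (1 - A).det := by
    have h1 : (1 : ℂ) ∉ spectrum ℂ (A.map (algebraMap ℝ ℂ)) := fun h => by
      have := hspec 1 h
      norm_num at this
    have h2 := spectrum.notMem_iff.1 h1
    rw [map_one] at h2
    have h3 : (1 : Matrix (Fin n) (Fin n) ℂ) - A.map (algebraMap ℝ ℂ)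
        = (algebraMap ℝ ℂ).mapMatrix (1 - A) := by
      rw [map_sub, map_one]; rfl
    rw [h3, Matrix.isUnit_iff_isUnit_det, ← RingHom.map_det] at h2
    exact (isUnit_map_iff (algebraMap ℝ ℂ) _).1 h2
  obtain ⟨N, hN⟩ : ∃ N : Matrix (Fin n) (Fin n) ℝ, N * (1 - A) = 1 :=
    ⟨(1 - A)⁻¹, Matrix.nonsing_inv_mul _ hdet⟩
  have hN' : (1 - A) * N = 1 := mul_eq_one_comm.1 hN
  have hB : ∀ z ∈ spectrum ℂ (((1 + A) * N).map (algebraMap ℝ ℂ)), ‖z‖ < 1 := by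
    have e : ((1 + A) * N).map (algebraMap ℝ ℂ)
        = (1 + A.map (algebraMap ℝ ℂ)) * N.map (algebraMap ℝ ℂ) := by
      have := map_mul (algebraMap ℝ ℂ).mapMatrix (1 + A) N
      rw [map_add, map_one] at this
      exact this
    rw [e]
    refine aux_cayley _ _ hspec ?_
    have := congrArg (algebraMap ℝ ℂ).mapMatrix hN
    rw [map_mul, map_sub, map_one] at this
    exact this
  have hQ' : ((2 : ℝ) • (Nᵀ * Q * N)).PosDef := by
    have := hQ.conjTranspose_mul_mul_same (B := N)
      (Matrix.mulVec_injective_of_isUnit (IsUnit.of_mul_eq_one _ hN))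
    rw [conjTranspose_eq_transpose_of_trivial] at this
    exact this.smul (by norm_num)
  obtain ⟨R, hR, hRe⟩ := aux_stein _ _ hB hQ'
  refine ⟨R, hR, ?_⟩
  have hNt : (1 - A)ᵀ * Nᵀ = 1 := by rw [← transpose_mul, hN, transpose_one]
  have h1 : (1 - A)ᵀ * R * (1 - A) = (2 : ℝ) • Q + (1 + A)ᵀ * R * (1 + A) := by
    calc (1 - A)ᵀ * R * (1 - A)
        = (1 - A)ᵀ * ((2 : ℝ) • (Nᵀ * Q * N) + ((1 + A) * N)ᵀ * R * ((1 + A) * N)) * (1 - A) := by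
          rw [← hRe]
      _ = (2 : ℝ) • (((1 - A)ᵀ * Nᵀ) * Q * (N * (1 - A)))
          + ((1 - A)ᵀ * Nᵀ) * ((1 + A)ᵀ * R * (1 + A)) * (N * (1 - A)) := by
          rw [transpose_mul (1 + A) N]
          simp only [mul_add, add_mul, mul_smul_comm, smul_mul_assoc, mul_assoc]
      _ = _ := by rw [hNt, hN]; simp
  have h2 : (2 : ℝ) • (R * A + Aᵀ * R) = (2 : ℝ) • (-Q) := by
    rw [transpose_sub, transpose_add, transpose_one] at h1
    have h3 : (2 : ℝ) • Q = (1 - Aᵀ) * R * (1 - A) - (1 + Aᵀ) * R * (1 + A) := by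
      rw [h1]; abel
    rw [smul_neg, h3, two_smul]
    noncomm_ring
  exact smul_right_injective _ (two_ne_zero : (2 : ℝ) ≠ 0) h2
end

section
/- Let w : ℕ → ℝ and b : ℕ → ℝ be sequences with w(k) ≥ 0 and b(k) ≥ 0 for all k, with ∑_k b(k) < ∞. Let c > 0 and ζ ∈ (0, 1], and suppose there is k₀ such that for all k ≥ k₀ one has c·k^{−ζ} ≤ 1 and w(k+1) ≤ (1 − c·k^{−ζ})·w(k) + b(k). Then w(k) → 0 as k → ∞. -/
open Filter

theorem perturbed_contraction_tendsto_zero (w b : ℕ → ℝ)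
    (hw : ∀ k, 0 ≤ w k) (hb : ∀ k, 0 ≤ b k) (hsum : Summable b)
    (c ζ : ℝ) (hc : 0 < c) (hζ0 : 0 < ζ) (hζ1 : ζ ≤ 1)
    (k₀ : ℕ)
    (hstep : ∀ k ≥ k₀, c * (k : ℝ) ^ (-ζ) ≤ 1)
    (hrec : ∀ k ≥ k₀, w (k + 1) ≤ (1 - c * (k : ℝ) ^ (-ζ)) * w k + b k) :
    Tendsto w atTop (nhds 0) := by
  obtain ⟨a, ha⟩ : ∃ a : ℕ → ℝ, a = fun k : ℕ => c * (k : ℝ) ^ (-ζ) := ⟨_, rfl⟩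
  have ha0 : ∀ k, 0 ≤ a k := fun k => by rw [ha]; positivity
  have hns : ¬ Summable a := by
    rw [ha, summable_mul_left_iff hc.ne', Real.summable_nat_rpow]
    linarith
  have hr : ∀ n, w (n + 1 + k₀) ≤ (1 - a (n + k₀)) * w (n + k₀) + b (n + k₀) := by
    intro n
    have := hrec (n + k₀) (by omega)
    rw [ha, show n + 1 + k₀ = n + k₀ + 1 by omega]
    exact this
  have hbs : Summable (fun n => b (n + k₀)) := (summable_nat_add_iff k₀).2 hsum
  have hbt : ∀ n, ∑ i ∈ Finset.range n, b (i + k₀) ≤ ∑' i, b (i + k₀) := fun n =>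
    hbs.sum_le_tsum _ (fun i _ => hb _)
  have hanti : Antitone (fun n => w (n + k₀) - ∑ i ∈ Finset.range n, b (i + k₀)) := by
    apply antitone_nat_of_succ_le
    intro n
    rw [Finset.sum_range_succ]
    nlinarith [hr n, mul_nonneg (ha0 (n + k₀)) (hw (n + k₀))]
  have hbdd : BddBelow (Set.range (fun n => w (n + k₀) - ∑ i ∈ Finset.range n, b (i + k₀))) := by
    refine ⟨-∑' i, b (i + k₀), ?_⟩
    rintro _ ⟨n, rfl⟩
    have h1 := hbt n
    have h2 := hw (n + k₀)
    dsimp only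
    linarith
  have hlim := (tendsto_atTop_ciInf hanti hbdd).add hbs.hasSum.tendsto_sum_nat
  simp only [sub_add_cancel] at hlim
  generalize (⨅ n, (w (n + k₀) - ∑ i ∈ Finset.range n, b (i + k₀))) + ∑' i, b (i + k₀) = L at hlim
  have hL : 0 ≤ L := ge_of_tendsto' hlim (fun n => hw _)
  have hwL : Tendsto w atTop (nhds L) := (tendsto_add_atTop_iff_nat k₀).1 hlim
  rcases hL.eq_or_lt with h | hpos
  · rwa [h]
  exfalso
  have htel : ∀ n, ∑ i ∈ Finset.range n, a (i + k₀) * w (i + k₀) ≤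
      w k₀ - w (n + k₀) + ∑ i ∈ Finset.range n, b (i + k₀) := by
    intro n
    induction n with
    | zero => simp
    | succ n ih =>
      rw [Finset.sum_range_succ, Finset.sum_range_succ]
      linarith [hr n]
  have hs : Summable (fun n => a (n + k₀) * w (n + k₀)) := by
    refine summable_of_sum_range_le (c := w k₀ + ∑' i, b (i + k₀))
      (fun n => mul_nonneg (ha0 _) (hw _)) (fun n => ?_)
    linarith [htel n, hbt n, hw (n + k₀)]
  have hs' : Summable (fun n => a n * w n) :=
    (summable_nat_add_iff (f := fun n => a n * w n) k₀).1 hs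
  apply hns
  refine summable_of_isBigO_nat hs' (Asymptotics.IsBigO.of_bound (2 / L) ?_)
  filter_upwards [hwL.eventually (lt_mem_nhds (half_lt_self hpos))] with n hn
  rw [Real.norm_of_nonneg (ha0 n), Real.norm_of_nonneg (mul_nonneg (ha0 n) (hw n))]
  have : 1 ≤ 2 / L * w n := by
    rw [div_mul_eq_mul_div, le_div_iff₀ hpos]; linarith
  nlinarith [mul_le_mul_of_nonneg_left this (ha0 n)]
end

section
/- Let w : ℕ → ℝ be a nonnegative sequence, let c, C > 0, let 0 < ζ < 1 and η > ζ, and suppose there is k₀ ≥ 1 such that for all k ≥ k₀ one has c·k^{−ζ} ≤ 1 and w(k+1) ≤ (1 − c·k^{−ζ})·w(k) + C·k^{−η}. Then for every δ with 0 ≤ δ < η − ζ, the sequence k^{δ}·w(k) tends to 0 as k → ∞. -/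
open Filter

theorem polynomial_rate_convergence (w : ℕ → ℝ) (hw : ∀ k, 0 ≤ w k)
    (c C : ℝ) (hc : 0 < c) (hC : 0 < C)
    (ζ η : ℝ) (hζ0 : 0 < ζ) (hζ1 : ζ < 1) (hη : ζ < η)
    (k₀ : ℕ) (hk₀ : 1 ≤ k₀)
    (hstep : ∀ k ≥ k₀, c * (k : ℝ) ^ (-ζ) ≤ 1)
    (hrec : ∀ k ≥ k₀, w (k + 1) ≤ (1 - c * (k : ℝ) ^ (-ζ)) * w k + C * (k : ℝ) ^ (-η)) :
    ∀ δ : ℝ, 0 ≤ δ → δ < η - ζ →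
      Tendsto (fun k : ℕ => (k : ℝ) ^ δ * w k) atTop (nhds 0) := by
  intro δ hδ0 hδ
  obtain ⟨γ, hγ⟩ : ∃ γ, γ = η - ζ := ⟨_, rfl⟩
  rw [← hγ] at hδ
  have hγ0 : 0 < γ := by linarith
  have hlarge : ∀ᶠ k : ℕ in atTop, 2 * γ / c ≤ (k : ℝ) ^ (1 - ζ) :=
    ((tendsto_rpow_atTop (by linarith : 0 < 1 - ζ)).comp
      tendsto_natCast_atTop_atTop).eventually_ge_atTop _
  obtain ⟨K₁, hK₁⟩ := eventually_atTop.1 hlarge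
  obtain ⟨K, hK⟩ : ∃ K, K = max k₀ K₁ := ⟨_, rfl⟩
  have hKk : k₀ ≤ K := hK ▸ le_max_left _ _
  have hKK : K₁ ≤ K := hK ▸ le_max_right _ _
  obtain ⟨M, hM⟩ : ∃ M, M = max (2 * C / c) (w K * (K : ℝ) ^ γ) := ⟨_, rfl⟩
  have hM1 : 2 * C / c ≤ M := hM ▸ le_max_left _ _
  have hM2 : w K * (K : ℝ) ^ γ ≤ M := hM ▸ le_max_right _ _
  have hM0 : 0 < M := lt_of_lt_of_le (by positivity) hM1
  have hbound : ∀ k ≥ K, w k ≤ M * (k : ℝ) ^ (-γ) := by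
    intro k hk
    induction k, hk using Nat.le_induction with
    | base =>
      have hKpos : (0 : ℝ) < K := by exact_mod_cast (by omega : 0 < K)
      rw [Real.rpow_neg hKpos.le, ← div_eq_mul_inv, le_div_iff₀ (by positivity)]
      exact hM2
    | succ k hk ih =>
      have hkpos : (0 : ℝ) < k := by exact_mod_cast (by omega : 0 < k)
      have h1 := hrec k (by omega)
      have h2 := hstep k (by omega)
      have h3 := hK₁ k (by omega)
      have hsplit : (k : ℝ) ^ (-η) = (k : ℝ) ^ (-γ) * (k : ℝ) ^ (-ζ) := by
        rw [← Real.rpow_add hkpos]; congr 1; rw [hγ]; ring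
      have hp : 0 < (k : ℝ) ^ (-γ) := by positivity
      have hq : 0 < (k : ℝ) ^ (-ζ) := by positivity
      have hone : (k : ℝ) ^ (1 - ζ) = k * (k : ℝ) ^ (-ζ) := by
        rw [sub_eq_add_neg, Real.rpow_add hkpos, Real.rpow_one]
      rw [hone, div_le_iff₀ hc] at h3
      have h4 : γ / k ≤ c / 2 * (k : ℝ) ^ (-ζ) := by
        rw [div_le_iff₀ hkpos]; linarith
      have h5 : (k : ℝ) ^ (-γ) * (1 - γ / k) ≤ ((k + 1 : ℕ) : ℝ) ^ (-γ) := by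
        have e : ((k + 1 : ℕ) : ℝ) = k * (1 + 1 / k) := by
          push_cast; field_simp
        have hx : (0 : ℝ) < 1 + 1 / k := by positivity
        rw [e, Real.mul_rpow hkpos.le hx.le]
        refine mul_le_mul_of_nonneg_left ?_ hp.le
        rw [Real.rpow_def_of_pos hx]
        have hl := Real.log_le_sub_one_of_pos hx
        have he := Real.add_one_le_exp (Real.log (1 + 1 / (k : ℝ)) * -γ)
        have hm := mul_le_mul_of_nonneg_left hl hγ0.le
        have : γ * (1 + 1 / (k : ℝ) - 1) = γ / k := by ring
        linarith
      have h6 : (1 - c * (k : ℝ) ^ (-ζ)) * w k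
          ≤ (1 - c * (k : ℝ) ^ (-ζ)) * (M * (k : ℝ) ^ (-γ)) :=
        mul_le_mul_of_nonneg_left ih (by linarith)
      rw [hsplit] at h1
      have h7 : 2 * C ≤ M * c := (div_le_iff₀ hc).1 hM1
      have h8 := mul_le_mul_of_nonneg_left h5 hM0.le
      have h9 := mul_le_mul_of_nonneg_left h4 (mul_pos hM0 hp).le
      have h10 := mul_le_mul_of_nonneg_right h7 (mul_pos hp hq).le
      linarith
  have hlim : Tendsto (fun k : ℕ => M * (k : ℝ) ^ (-(γ - δ))) atTop (nhds 0) := by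
    have := ((tendsto_rpow_neg_atTop (by linarith : 0 < γ - δ)).comp
      tendsto_natCast_atTop_atTop).const_mul M
    simpa using this
  refine squeeze_zero' (Eventually.of_forall fun k => mul_nonneg (by positivity) (hw k)) ?_ hlim
  filter_upwards [eventually_ge_atTop K] with k hk
  have hkpos : (0 : ℝ) < k := by exact_mod_cast (by omega : 0 < k)
  have h := mul_le_mul_of_nonneg_left (hbound k hk) (by positivity : 0 ≤ (k : ℝ) ^ δ)
  have e : (k : ℝ) ^ (-(γ - δ)) = (k : ℝ) ^ δ * (k : ℝ) ^ (-γ) := by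
    rw [← Real.rpow_add hkpos]; congr 1; ring
  rw [e]
  linarith
end

section
/- Let w : ℕ → ℝ be a nonnegative sequence, let c, s, C > 0, and suppose there is k₀ ≥ 1 such that for all k ≥ k₀ one has c/k ≤ 1 and w(k+1) ≤ (1 − c/k)·w(k) + C·k^{−(1+s)}. Then for every δ with 0 ≤ δ < min(c, s), the sequence k^{δ}·w(k) tends to 0 as k → ∞. -/
open Filter

theorem polynomial_rate_convergence_critical (w : ℕ → ℝ) (hw : ∀ k, 0 ≤ w k)
    (c s C : ℝ) (hc : 0 < c) (hs : 0 < s) (hC : 0 < C)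
    (k₀ : ℕ) (hk₀ : 1 ≤ k₀)
    (hstep : ∀ k ≥ k₀, c / (k : ℝ) ≤ 1)
    (hrec : ∀ k ≥ k₀, w (k + 1) ≤ (1 - c / (k : ℝ)) * w k + C * (k : ℝ) ^ (-(1 + s))) :
    ∀ δ : ℝ, 0 ≤ δ → δ < min c s →
      Tendsto (fun k : ℕ => (k : ℝ) ^ δ * w k) atTop (nhds 0) := by
  intro δ hδ hδm
  obtain ⟨e, hδe, hem⟩ := exists_between hδm
  have hec : e < c := lt_of_lt_of_le hem (min_le_left _ _)
  have hes : e < s := lt_of_lt_of_le hem (min_le_right _ _)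
  have he : 0 < e := lt_of_le_of_lt hδ hδe
  obtain ⟨M, hM1, hM2⟩ : ∃ M : ℝ, C / (c - e) ≤ M ∧ w k₀ * (k₀ : ℝ) ^ e ≤ M :=
    ⟨max _ _, le_max_left _ _, le_max_right _ _⟩
  have hCM : C ≤ M * (c - e) := (div_le_iff₀ (by linarith)).1 hM1
  have hM0 : 0 ≤ M := le_trans (div_nonneg hC.le (by linarith)) hM1
  have key : ∀ k ≥ k₀, w k ≤ M * (k : ℝ) ^ (-e) := by
    intro k hk
    induction k, hk using Nat.le_induction with
    | base =>
      have h0 : (0 : ℝ) < k₀ := by exact_mod_cast hk₀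
      rw [Real.rpow_neg h0.le, ← div_eq_mul_inv, le_div_iff₀ (Real.rpow_pos_of_pos h0 _)]
      exact hM2
    | succ k hk ih =>
      have h1 : (1 : ℝ) ≤ k := by exact_mod_cast hk₀.trans hk
      have h0 : (0 : ℝ) < k := by linarith
      have hP : 0 < (k : ℝ) ^ (-e) := Real.rpow_pos_of_pos h0 _
      have hA : (k : ℝ) ^ (-(1 + s)) ≤ (k : ℝ) ^ (-e) / k := by
        calc (k : ℝ) ^ (-(1 + s)) ≤ (k : ℝ) ^ (-e - 1) :=
              Real.rpow_le_rpow_of_exponent_le h1 (by linarith)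
          _ = _ := by rw [Real.rpow_sub h0, Real.rpow_one]
      have hB : (k : ℝ) ^ (-e) * (1 - e / k) ≤ ((k + 1 : ℕ) : ℝ) ^ (-e) := by
        have hfac : ((k + 1 : ℕ) : ℝ) = k * (1 + 1 / k) := by
          push_cast; field_simp
        have hpos : (0 : ℝ) < 1 + 1 / k := by positivity
        rw [hfac, Real.mul_rpow h0.le hpos.le]
        refine mul_le_mul_of_nonneg_left ?_ hP.le
        rw [Real.rpow_def_of_pos hpos]
        have hl := Real.log_le_sub_one_of_pos hpos
        have hx := Real.add_one_le_exp (Real.log (1 + 1 / k) * -e)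
        have h3 : Real.log (1 + 1 / (k : ℝ)) * e ≤ 1 / k * e :=
          mul_le_mul_of_nonneg_right (by linarith) he.le
        have h4 : 1 / (k : ℝ) * e = e / k := by ring
        linarith
      have hQ : 0 ≤ (k : ℝ) ^ (-e) / k := by positivity
      calc w (k + 1) ≤ _ := hrec k hk
        _ ≤ (1 - c / k) * (M * (k : ℝ) ^ (-e)) + M * (c - e) * ((k : ℝ) ^ (-e) / k) := by
          refine add_le_add (mul_le_mul_of_nonneg_left ih (by linarith [hstep k hk])) ?_
          exact (mul_le_mul_of_nonneg_left hA hC.le).trans (mul_le_mul_of_nonneg_right hCM hQ)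
        _ = M * ((k : ℝ) ^ (-e) * (1 - e / k)) := by ring
        _ ≤ _ := mul_le_mul_of_nonneg_left hB hM0
  have hlim : Tendsto (fun k : ℕ => M * (k : ℝ) ^ (-(e - δ))) atTop (nhds 0) := by
    have := ((tendsto_rpow_neg_atTop (sub_pos.2 hδe)).comp
      (tendsto_natCast_atTop_atTop (R := ℝ))).const_mul M
    simpa using this
  refine tendsto_of_tendsto_of_tendsto_of_le_of_le' tendsto_const_nhds hlim ?_ ?_
  · exact Eventually.of_forall fun k => mul_nonneg (by positivity) (hw k)
  · filter_upwards [eventually_ge_atTop k₀] with k hk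
    have h0 : (0 : ℝ) < k := by exact_mod_cast hk₀.trans hk
    calc (k : ℝ) ^ δ * w k ≤ (k : ℝ) ^ δ * (M * (k : ℝ) ^ (-e)) :=
          mul_le_mul_of_nonneg_left (key k hk) (by positivity)
      _ = M * ((k : ℝ) ^ δ * (k : ℝ) ^ (-e)) := by ring
      _ = _ := by rw [← Real.rpow_add h0]; congr 2; ring
end

section
/- Let R be a commutative ring and let A and B be n×n matrices over R. Then the characteristic polynomial of the 2n×2n block matrix M = [[A, B], [−A, −B]] equals X^n times the characteristic polynomial of A − B. -/
open Matrix Polynomial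

theorem charpoly_fromBlocks_neg_rows {R : Type*} [CommRing R] {n : ℕ}
    (A B : Matrix (Fin n) (Fin n) R) :
    (Matrix.fromBlocks A B (-A) (-B)).charpoly = X ^ n * (A - B).charpoly := by
  have h : Matrix.fromBlocks A B (-A) (-B) =
      Matrix.fromRows (1 : Matrix (Fin n) (Fin n) R) (-1) * Matrix.fromCols A B := by
    rw [Matrix.fromRows_mul_fromCols]
    simp
  rw [h, Matrix.charpoly_mul_comm_of_le _ _ (by simp), Matrix.fromCols_mul_fromRows]
  simp [sub_eq_add_neg]
end

section
/- Let n ≥ 1, let Γ be an n×n real weighted Laplacian matrix all of whose diagonal entries are strictly negative, let D be the n×n diagonal matrix with D_{ii} = −Γ_{ii} > 0, and let P be an n×n diagonal real matrix with strictly positive diagonal entries. Consider the 2n×2n block matrix M = [[P·Γ, P·D], [−P·Γ, −P·D]]. Then 0 is an eigenvalue of M with algebraic multiplicity exactly n (i.e., X^n exactly divides the characteristic polynomial of M), and every nonzero complex eigenvalue of M has strictly negative real part. -/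
open Matrix Polynomial

theorem gersh_aux {n : ℕ} 
    (Γ : Matrix (Fin n) (Fin n) ℝ) (hΓ : IsWeightedLaplacian Γ)
    (hΓdiag : ∀ i, Γ i i < 0)
    (q : Fin n → ℝ) (hq : ∀ i, 0 < q i) (μ : ℂ)
    (h : ((Matrix.diagonal q * Γ - Matrix.diagonal q * Matrix.diagonal (fun i => -Γ i i)).map
      (algebraMap ℝ ℂ)).charpoly.IsRoot μ) : μ.re < 0 := by
  rw [← Matrix.charpoly_toLin', ← Module.End.hasEigenvalue_iff_isRoot_charpoly] at h
  obtain ⟨k, hk⟩ := eigenvalue_mem_ball h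
  have h1 : ∑ j ∈ Finset.univ.erase k, ‖((Matrix.diagonal q * Γ - Matrix.diagonal q * Matrix.diagonal (fun i => -Γ i i)).map
      (algebraMap ℝ ℂ)) k j‖ = q k * (- Γ k k) := by
    have h2 := hΓ.2 k
    rw [← Finset.add_sum_erase _ _ (Finset.mem_univ k)] at h2
    have h3 : - Γ k k = ∑ j ∈ Finset.univ.erase k, Γ k j := by linarith
    rw [h3, Finset.mul_sum]
    refine Finset.sum_congr rfl fun j hj => ?_
    have hj' : k ≠ j := (Finset.ne_of_mem_erase hj).symm
    have := mul_nonneg (hq k).le (hΓ.1 k j hj')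
    simp [Matrix.diagonal_mul, Matrix.diagonal_apply_ne _ hj', abs_of_pos (hq k), abs_of_nonneg (hΓ.1 k j hj')]
  rw [h1, mem_closedBall_iff_norm] at hk
  have h4 := (Complex.re_le_norm _).trans hk
  simp [Matrix.diagonal_mul] at h4
  have := mul_neg_of_pos_of_neg (hq k) (hΓdiag k)
  linarith

theorem charpoly_aux {n : ℕ} (A B : Matrix (Fin n) (Fin n) ℝ) :
    (Matrix.fromBlocks A B (-A) (-B)).charpoly = X ^ n * (A - B).charpoly := by
  have h := Matrix.charpoly_mul_comm' (Matrix.fromRows (1 : Matrix (Fin n) (Fin n) ℝ) (-1)) (Matrix.fromCols A B)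
  rw [Matrix.fromRows_mul_fromCols, Matrix.fromCols_mul_fromRows] at h
  simp only [one_mul, neg_mul, mul_one, mul_neg, Fintype.card_sum, Fintype.card_fin, pow_add, mul_assoc, ← sub_eq_add_neg] at h
  exact mul_left_cancel₀ (pow_ne_zero n X_ne_zero) h

theorem offset_block_matrix_spectrum {n : ℕ} (hn : 1 ≤ n)
    (Γ : Matrix (Fin n) (Fin n) ℝ) (hΓ : IsWeightedLaplacian Γ)
    (hΓdiag : ∀ i, Γ i i < 0)
    (q : Fin n → ℝ) (hq : ∀ i, 0 < q i) :
    X ^ n ∣ (Matrix.fromBlocks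
        (Matrix.diagonal q * Γ) (Matrix.diagonal q * Matrix.diagonal (fun i => -Γ i i))
        (-(Matrix.diagonal q * Γ)) (-(Matrix.diagonal q * Matrix.diagonal (fun i => -Γ i i)))).charpoly ∧
    ¬ X ^ (n + 1) ∣ (Matrix.fromBlocks
        (Matrix.diagonal q * Γ) (Matrix.diagonal q * Matrix.diagonal (fun i => -Γ i i))
        (-(Matrix.diagonal q * Γ)) (-(Matrix.diagonal q * Matrix.diagonal (fun i => -Γ i i)))).charpoly ∧
    ∀ μ : ℂ, μ ≠ 0 →
      ((Matrix.fromBlocks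
        (Matrix.diagonal q * Γ) (Matrix.diagonal q * Matrix.diagonal (fun i => -Γ i i))
        (-(Matrix.diagonal q * Γ)) (-(Matrix.diagonal q * Matrix.diagonal (fun i => -Γ i i)))).map
          (algebraMap ℝ ℂ)).charpoly.IsRoot μ → μ.re < 0 := by
  rw [Matrix.charpoly_map, charpoly_aux]
  refine ⟨dvd_mul_right _ _, fun h => ?_, fun μ hμ h => ?_⟩
  · rw [pow_succ] at h
    have h0 := (mul_dvd_mul_iff_left (pow_ne_zero n X_ne_zero)).1 h
    have h1 := gersh_aux Γ hΓ hΓdiag q hq 0 (by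
      rw [Matrix.charpoly_map, Polynomial.IsRoot.def, ← map_zero (algebraMap ℝ ℂ),
        Polynomial.eval_map_algebraMap, Polynomial.aeval_algebraMap_apply]
      rw [Polynomial.X_dvd_iff, Polynomial.coeff_zero_eq_eval_zero] at h0
      rw [Polynomial.coe_aeval_eq_eval, h0])
    simp at h1
  · refine gersh_aux Γ hΓ hΓdiag q hq μ ?_
    rw [Matrix.charpoly_map]
    simpa [Polynomial.IsRoot.def, hμ] using h
end

section
/- Let n ≥ 1, let Γ be an n×n real weighted Laplacian matrix having the spanning-tree property, and let D be an n×n diagonal real matrix with strictly positive diagonal entries. If f ∈ ℝⁿ and c ∈ ℝ satisfy Γ·f + c·(D·𝟙) = 0, then c = 0 and there exists θ ∈ ℝ such that f = θ·𝟙. -/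
open Matrix

theorem aux_le_at_max {n : ℕ} (Γ : Matrix (Fin n) (Fin n) ℝ)
    (hΓ : IsWeightedLaplacian Γ) (f : Fin n → ℝ) (i : Fin n) (hi : ∀ j, f j ≤ f i) (j : Fin n) :
    Γ i j * (f j - f i) ≤ 0 := by
  by_cases hij : i = j
  · subst hij; simp
  · exact mul_nonpos_of_nonneg_of_nonpos (hΓ.1 i j hij) (by linarith [hi j])

theorem aux_root_max {n : ℕ} (Γ : Matrix (Fin n) (Fin n) ℝ)
    (hΓ : IsWeightedLaplacian Γ) (r : Fin n)
    (hr : ∀ i : Fin n, Relation.ReflTransGen (fun a b : Fin n => b ≠ a ∧ 0 < Γ b a) r i)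
    (f : Fin n → ℝ) (hf : ∀ i, ∑ j, Γ i j * (f j - f i) = 0) (k : Fin n) : f k ≤ f r := by
  haveI : Nonempty (Fin n) := ⟨r⟩
  obtain ⟨m, hm⟩ := Finite.exists_max f
  have key : f r = f m := by
    refine Relation.ReflTransGen.head_induction_on (motive := fun a _ => f a = f m) (hr m) rfl ?_
    intro a b hab _ hb
    have hmax : ∀ j, f j ≤ f b := fun j => hb ▸ hm j
    have h0 := (Finset.sum_eq_zero_iff_of_nonpos
      (fun j _ => aux_le_at_max Γ hΓ f b hmax j)).1 (hf b) a (Finset.mem_univ a)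
    rcases mul_eq_zero.1 h0 with h1 | h1
    · exact absurd h1 hab.2.ne'
    · linarith
  rw [key]; exact hm k

theorem laplacian_kernel_with_diagonal_forcing {n : ℕ} (hn : 1 ≤ n)
    (Γ : Matrix (Fin n) (Fin n) ℝ)
    (hΓ : IsWeightedLaplacian Γ) (hTree : HasSpanningTree Γ)
    (d : Fin n → ℝ) (hd : ∀ i, 0 < d i)
    (f : Fin n → ℝ) (c : ℝ)
    (h : Γ.mulVec f + c • (Matrix.diagonal d).mulVec (fun _ => 1) = 0) :
    c = 0 ∧ ∃ θ : ℝ, f = fun _ => θ := by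
  have hs : ∀ i, ∑ j, Γ i j * (f j - f i) = - (c * d i) := by
    intro i
    have hi := congrFun h i
    simp only [Pi.add_apply, Pi.smul_apply, Matrix.mulVec_diagonal, smul_eq_mul, mul_one,
      Pi.zero_apply] at hi
    simp only [mul_sub, Finset.sum_sub_distrib, ← Finset.sum_mul, hΓ.2 i]
    have : Γ.mulVec f i = ∑ j, Γ i j * f j := rfl
    linarith
  obtain ⟨r, hr⟩ := hTree
  haveI : Nonempty (Fin n) := ⟨r⟩
  have hneg : ∀ i j, Γ i j * ((-f) j - (-f) i) = - (Γ i j * (f j - f i)) := by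
    intro i j; simp only [Pi.neg_apply]; ring
  have hc : c = 0 := by
    obtain ⟨m, hm⟩ := Finite.exists_max f
    obtain ⟨p, hp⟩ := Finite.exists_max (-f)
    have h1 := Finset.sum_nonpos (s := Finset.univ)
      (fun j _ => aux_le_at_max Γ hΓ f m hm j)
    have h2 := Finset.sum_nonpos (s := Finset.univ)
      (fun j _ => aux_le_at_max Γ hΓ (-f) p hp j)
    simp only [hneg, Finset.sum_neg_distrib] at h2
    rw [hs] at h1 h2
    apply le_antisymm
    · by_contra! hlt
      linarith [mul_pos hlt (hd p)]
    · by_contra! hlt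
      linarith [mul_neg_of_neg_of_pos hlt (hd m)]
  subst hc
  refine ⟨rfl, f r, ?_⟩
  funext k
  apply le_antisymm
  · exact aux_root_max Γ hΓ r hr f (fun i => by rw [hs]; simp) k
  · have := aux_root_max Γ hΓ r hr (-f)
      (fun i => by simp only [hneg, Finset.sum_neg_distrib, hs]; simp) k
    simp only [Pi.neg_apply] at this
    linarith
end

section
/- Let n ≥ 1 and let L be an n×n real weighted Laplacian matrix having the spanning-tree property. Then the rank of L equals n − 1, the kernel of L (as a linear map on ℝⁿ) is spanned by the all-ones vector 𝟙, and 𝟙 does not belong to the column space (range) of L. -/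
open Matrix

lemma lap_mulVec {n : ℕ} (L : Matrix (Fin n) (Fin n) ℝ) (hL : IsWeightedLaplacian L)
    (x : Fin n → ℝ) (i : Fin n) : (L *ᵥ x) i = ∑ j, L i j * (x j - x i) := by
  simp only [mul_sub, Finset.sum_sub_distrib, ← Finset.sum_mul, hL.2 i]
  simp [Matrix.mulVec, dotProduct]

lemma lap_term {n : ℕ} (L : Matrix (Fin n) (Fin n) ℝ) (hL : IsWeightedLaplacian L)
    (x : Fin n → ℝ) (i : Fin n) (hi : ∀ j, x j ≤ x i) (j : Fin n) :
    L i j * (x j - x i) ≤ 0 := by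
  by_cases h : i = j
  · subst h; simp
  · exact mul_nonpos_of_nonneg_of_nonpos (hL.1 i j h) (sub_nonpos.2 (hi j))

lemma lap_root {n : ℕ} (L : Matrix (Fin n) (Fin n) ℝ) (hL : IsWeightedLaplacian L)
    (r : Fin n) (hr : ∀ i : Fin n,
      Relation.ReflTransGen (fun a b : Fin n => b ≠ a ∧ 0 < L b a) r i)
    (x : Fin n → ℝ) (hx : L *ᵥ x = 0) (j : Fin n) : x j ≤ x r := by
  haveI : Nonempty (Fin n) := ⟨r⟩
  obtain ⟨m, hm⟩ := Finite.exists_max x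
  suffices h : ∀ i, Relation.ReflTransGen (fun a b : Fin n => b ≠ a ∧ 0 < L b a) r i →
      (∀ k, x k ≤ x i) → ∀ k, x k ≤ x r from h m (hr m) hm j
  intro i hi
  induction hi with
  | refl => exact id
  | @tail a b _ hab ih =>
    intro hb
    apply ih
    have h0 : ∑ k, L b k * (x k - x b) = 0 := by
      rw [← lap_mulVec L hL, hx]; rfl
    have h1 := (Finset.sum_eq_zero_iff_of_nonpos
      (fun k _ => lap_term L hL x b hb k)).1 h0 a (Finset.mem_univ a)
    have h2 : x a = x b := by
      rcases mul_eq_zero.1 h1 with h | h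
      · exact absurd h hab.2.ne'
      · linarith
    rw [h2]; exact hb

theorem laplacian_rank_kernel_range {n : ℕ} (hn : 1 ≤ n)
    (L : Matrix (Fin n) (Fin n) ℝ)
    (hL : IsWeightedLaplacian L) (hTree : HasSpanningTree L) :
    L.rank = n - 1 ∧
    LinearMap.ker L.mulVecLin = Submodule.span ℝ {fun _ => (1 : ℝ)} ∧
    (fun _ => (1 : ℝ)) ∉ LinearMap.range L.mulVecLin := by
  obtain ⟨r, hr⟩ := hTree
  haveI : Nonempty (Fin n) := ⟨r⟩
  have hker : LinearMap.ker L.mulVecLin = Submodule.span ℝ {fun _ => (1 : ℝ)} := by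
    ext x
    rw [LinearMap.mem_ker, Matrix.mulVecLin_apply, Submodule.mem_span_singleton]
    constructor
    · intro hx
      refine ⟨x r, ?_⟩
      ext j
      have h1 := lap_root L hL r hr x hx j
      have h2 := lap_root L hL r hr (-x) (by rw [Matrix.mulVec_neg, hx, neg_zero]) j
      simp only [Pi.neg_apply] at h2
      simp only [Pi.smul_apply, smul_eq_mul, mul_one]
      linarith
    · rintro ⟨c, rfl⟩
      ext i
      rw [lap_mulVec L hL]
      simp
  refine ⟨?_, hker, ?_⟩
  · have h := LinearMap.finrank_range_add_finrank_ker L.mulVecLin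
    rw [hker, finrank_span_singleton (fun h => one_ne_zero (congrFun h r))] at h
    simp only [Module.finrank_fin_fun] at h
    unfold Matrix.rank
    omega
  · rintro ⟨x, hx⟩
    obtain ⟨m, hm⟩ := Finite.exists_max x
    have h1 := lap_mulVec L hL x m
    have h2 : (L *ᵥ x) m = 1 := congrFun hx m
    have h3 := Finset.sum_nonpos (fun k (_ : k ∈ Finset.univ) => lap_term L hL x m hm k)
    linarith
end
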